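/- For every a ∈ ℤ, there are only finitely many isomorphism classes of indecomposable e(2)-modules V with lowest weight a and dim_ℂ V ≤ 5; that is, there exists a finite list V¹, …, Vⁿ of e(2)-modules such that every indecomposable e(2)-module V of complex dimension at most five satisfying V_a ≠ 0 and V_k = 0 for all k < a is isomorphic to some Vʲ. -/

import Mathlib

/-- An `e(2)`-module: a finite-dimensional complex vector space `V` with endomorphisms
`Pp = P₊`, `Pm = P₋`, `L` satisfying `P₊∘P₋ = P₋∘P₊`, `L∘P₊ − P₊∘L = P₊`,
`L∘P₋ − P₋∘L = −P₋`, such that `V` is the internal direct sum of the eigenspaces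
`V_k = ker (L − k·id)`, `k ∈ ℤ`. -/
structure E2Mod : Type 1 where
  V : Type
  [acg : AddCommGroup V]
  [mod : Module ℂ V]
  [fd : FiniteDimensional ℂ V]
  Pp : V →ₗ[ℂ] V
  Pm : V →ₗ[ℂ] V
  L : V →ₗ[ℂ] V
  comm : Pp.comp Pm = Pm.comp Pp
  relp : L.comp Pp - Pp.comp L = Pp
  relm : L.comp Pm - Pm.comp L = -Pm
  internal : DirectSum.IsInternal fun k : ℤ =>
    LinearMap.ker (L - (k : ℂ) • (LinearMap.id : V →ₗ[ℂ] V))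

attribute [instance] E2Mod.acg E2Mod.mod E2Mod.fd

namespace E2Mod

/-- The `k`-weight space `V_k = ker (L - k·id)`. -/
def wt (M : E2Mod) (k : ℤ) : Submodule ℂ M.V :=
  LinearMap.ker (M.L - (k : ℂ) • (LinearMap.id : M.V →ₗ[ℂ] M.V))

/-- A subspace is a submodule if it is invariant under `P₊`, `P₋` and `L`. -/
def IsSubmod (M : E2Mod) (S : Submodule ℂ M.V) : Prop :=
  (∀ v ∈ S, M.Pp v ∈ S) ∧ (∀ v ∈ S, M.Pm v ∈ S) ∧ (∀ v ∈ S, M.L v ∈ S)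

/-- An `e(2)`-module is indecomposable if it is nonzero and admits no nontrivial
decomposition as an internal direct sum of two submodules. -/
def Indecomposable (M : E2Mod) : Prop :=
  (∃ v : M.V, v ≠ 0) ∧
    ∀ W₁ W₂ : Submodule ℂ M.V, M.IsSubmod W₁ → M.IsSubmod W₂ →
      W₁ ⊓ W₂ = ⊥ → W₁ ⊔ W₂ = ⊤ → W₁ = ⊥ ∨ W₂ = ⊥

/-- Isomorphism of `e(2)`-modules: a bijective linear map commuting with `P₊, P₋, L`. -/
def Iso (M N : E2Mod) : Prop :=
  ∃ e : M.V ≃ₗ[ℂ] N.V,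
    (∀ v, e (M.Pp v) = N.Pp (e v)) ∧ (∀ v, e (M.Pm v) = N.Pm (e v)) ∧
      (∀ v, e (M.L v) = N.L (e v))

end E2Mod

open Submodule in
theorem exists_adapted_extension {K V : Type*} [Field K] [AddCommGroup V] [Module K V]
    [FiniteDimensional K V] {𝓕 : Set (Submodule K V)} (h𝓕 : IsChain (· ≤ ·) 𝓕)
    {W : Submodule K V} {B₀ : Set V} (hB₀ : LinearIndepOn K id B₀) (hW : span K B₀ ≤ W)
    (had : ∀ F ∈ 𝓕, span K B₀ ⊓ F ≤ span K (B₀ ∩ F)) :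
    ∃ B, B₀ ⊆ B ∧ LinearIndepOn K id B ∧ span K B = W ∧
      ∀ F ∈ 𝓕, W ⊓ F ≤ span K (B ∩ F) := by
  obtain ⟨S, ⟨B, hsub, hB, rfl, hBW, hBad⟩, hmax⟩ :=
    (wellFounded_gt (α := Submodule K V)).has_min
      {S | ∃ B, B₀ ⊆ B ∧ LinearIndepOn K id B ∧ span K B = S ∧ S ≤ W ∧
        ∀ F ∈ 𝓕, S ⊓ F ≤ span K (B ∩ F)}
      ⟨_, B₀, subset_rfl, hB₀, rfl, hW, had⟩
  suffices hle : W ≤ span K B by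
    obtain rfl := le_antisymm hBW hle
    exact ⟨B, hsub, hB, rfl, hBad⟩
  by_contra hle
  obtain ⟨v, hvW, hvB, hv⟩ : ∃ v ∈ W, v ∉ span K B ∧ ∀ F ∈ 𝓕, v ∈ F ∨ F ⊓ W ≤ span K B := by
    by_cases hne : {F | F ∈ 𝓕 ∧ ¬ F ⊓ W ≤ span K B}.Nonempty
    · obtain ⟨F₀, ⟨hF₀, hF₀'⟩, hmin⟩ := (wellFounded_lt (α := Submodule K V)).has_min _ hne
      obtain ⟨v, hv, hvB⟩ := SetLike.not_le_iff_exists.1 hF₀'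
      refine ⟨v, hv.2, hvB, fun F hF => or_iff_not_imp_right.2 fun hF' => ?_⟩
      rcases h𝓕.total hF₀ hF with h | h
      · exact h hv.1
      · rcases h.lt_or_eq with h | h
        · exact absurd h (hmin F ⟨hF, hF'⟩)
        · exact h ▸ hv.1
    · obtain ⟨v, hv, hvB⟩ := SetLike.not_le_iff_exists.1 hle
      refine ⟨v, hv, hvB, fun F hF => Or.inr ?_⟩
      by_contra h
      exact hne ⟨F, hF, h⟩
  refine hmax (span K (insert v B)) ⟨insert v B, hsub.trans (Set.subset_insert _ _),
    hB.id_insert hvB, rfl, ?_, fun F hF => ?_⟩ ?_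
  · rw [span_insert, sup_le_iff, span_singleton_le_iff_mem]
    exact ⟨hvW, hBW⟩
  · rintro u ⟨hu, huF⟩
    obtain ⟨c, z, hz, rfl⟩ := mem_span_insert.1 hu
    rcases hv F hF with hvF | hFB
    · refine add_mem (smul_mem _ _ (subset_span ⟨Set.mem_insert _ _, hvF⟩)) ?_
      have hzF : z ∈ F := by simpa using sub_mem huF (smul_mem F c hvF)
      exact span_mono (Set.inter_subset_inter_left _ (Set.subset_insert _ _))
        (hBad F hF ⟨hz, hzF⟩)
    · exact span_mono (Set.inter_subset_inter_left _ (Set.subset_insert _ _))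
        (hBad F hF ⟨hFB ⟨huF, add_mem (smul_mem _ _ hvW) (hBW hz)⟩, huF⟩)
  · exact lt_of_le_of_ne (span_mono (Set.subset_insert _ _))
      fun h => hvB (h ▸ subset_span (Set.mem_insert _ _))

open Submodule in
theorem exists_adapted_step {K V : Type*} [Field K] [AddCommGroup V] [Module K V]
    [FiniteDimensional K V] {p q : Module.End K V} (hpq : ∀ v, p (q v) = 0)
    {U W : Submodule K V} (hq : U ≤ W.comap q)
    {𝓕 : Set (Submodule K V)} (h𝓕 : IsChain (· ≤ ·) 𝓕) (hbot : ⊥ ∈ 𝓕) (hW : W ∈ 𝓕)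
    {A : Set V} (hA : LinearIndepOn K id A) (hAU : span K A = U)
    (hAp : ∀ F ∈ 𝓕, F.map p ≤ span K (A ∩ F.map p))
    (hAq : ∀ F ∈ 𝓕, U ⊓ F.comap q ≤ span K (A ∩ (U ⊓ F.comap q : Submodule K V))) :
    ∃ D, LinearIndepOn K id D ∧ span K D = W ∧
      (∀ F ∈ 𝓕, W ⊓ F ≤ span K (D ∩ F)) ∧ (∀ d ∈ D, p d = 0 ∨ p d ∈ A) ∧
      ∀ b ∈ A, q b = 0 ∨ q b ∈ D := by
  have hAsub : A ⊆ U := hAU ▸ subset_span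
  set A₁ : Set V := {b | b ∈ A ∧ q b ≠ 0} with hA₁
  set A₀ : Set V := {b | b ∈ A ∧ q b = 0} with hA₀
  have hker : U ⊓ LinearMap.ker q ≤ span K A₀ := by
    refine (hAq ⊥ hbot).trans (span_mono ?_)
    rintro b ⟨hb, -, hb'⟩
    exact ⟨hb, by simpa using hb'⟩
  have hdisj : Disjoint (span K A₁) (LinearMap.ker q) := by
    have hd : Disjoint A₁ A₀ := Set.disjoint_left.2 fun b h h' => h.2 h'.2
    have hun : A₁ ∪ A₀ = A := by
      ext b; simp only [hA₁, hA₀, Set.mem_union, Set.mem_ofPred_eq]; tauto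
    have := ((linearIndepOn_union_iff hd).1 (hun ▸ hA)).2.2
    simp only [Set.image_id] at this
    rw [Submodule.disjoint_def] at this ⊢
    intro z hz hz'
    refine this z hz (hker ⟨?_, hz'⟩)
    exact hAU ▸ span_mono (fun b hb => hb.1) hz
  have hC₁ : LinearIndepOn K id (q '' A₁) :=
    (hA.mono fun b hb => hb.1).image hdisj
  have hmapspan : ∀ S : Set V, S ⊆ A → ∀ u ∈ span K S, q u ∈ span K (q '' (A₁ ∩ S)) := by
    intro S hS u hu
    induction hu using span_induction with
    | mem b hb =>
      by_cases h : q b = 0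
      · simp [h]
      · exact subset_span ⟨b, ⟨⟨hS hb, h⟩, hb⟩, rfl⟩
    | zero => simp
    | add _ _ _ _ h₁ h₂ => simpa using add_mem h₁ h₂
    | smul c _ _ h => simpa using smul_mem _ c h
  obtain ⟨C, hC₁C, hC, hCspan, hCad⟩ := exists_adapted_extension h𝓕
    (W := W ⊓ LinearMap.ker p) hC₁ (by
      rw [span_le]
      rintro _ ⟨b, hb, rfl⟩
      exact ⟨hq (hAsub hb.1), hpq b⟩) (by
      rintro F hF _ ⟨hz, hzF⟩
      rw [← map_span] at hz
      obtain ⟨u, hu, rfl⟩ := hz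
      have huU : u ∈ U := hAU ▸ span_mono (fun b hb => hb.1) hu
      refine span_mono ?_ (hmapspan _ Set.inter_subset_left u (hAq F hF ⟨huU, hzF⟩))
      rintro _ ⟨b, hb, rfl⟩
      exact ⟨⟨b, hb.1, rfl⟩, hb.2.2.2⟩)
  have hc : ∀ b : V, ∃ c, b ∈ W.map p → c ∈ W ∧ p c = b ∧ ∀ F ∈ 𝓕, b ∈ F.map p → c ∈ F := by
    intro b
    by_cases hb : b ∈ W.map p
    · obtain ⟨F₀, ⟨hF₀, c, hc, hcb⟩, hmin⟩ := (wellFounded_lt (α := Submodule K V)).has_min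
        {F | F ∈ 𝓕 ∧ b ∈ F.map p} ⟨W, hW, hb⟩
      have key : ∀ F ∈ 𝓕, b ∈ F.map p → c ∈ F := by
        intro F hF hbF
        rcases h𝓕.total hF₀ hF with h | h
        · exact h hc
        · rcases h.lt_or_eq with h | h
          · exact absurd h (hmin F ⟨hF, hbF⟩)
          · exact h ▸ hc
      exact ⟨c, fun _ => ⟨key W hW hb, hcb, key⟩⟩
    · exact ⟨0, fun h => absurd h hb⟩
  choose c hc using hc
  set A₂ : Set V := A ∩ W.map p with hA₂
  have hpc : LinearIndepOn K (p ∘ c) A₂ :=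
    (hA.mono Set.inter_subset_left).congr fun b hb => ((hc b hb.2).2.1).symm
  have hadD : ∀ F ∈ 𝓕, W ⊓ F ≤ span K ((C ∪ c '' A₂) ∩ F) := by
    rintro F hF w ⟨hwW, hwF⟩
    have hlift : ∀ u ∈ span K (A ∩ ((W ⊓ F).map p : Submodule K V)),
        ∃ z ∈ span K (c '' A₂ ∩ F), z ∈ W ∧ p z = u := by
      intro u hu
      induction hu using span_induction with
      | mem b hb =>
        have h1 : b ∈ W.map p := map_mono inf_le_left hb.2
        have h2 : b ∈ F.map p := map_mono inf_le_right hb.2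
        exact ⟨c b, subset_span ⟨⟨b, ⟨hb.1, h1⟩, rfl⟩, (hc b h1).2.2 F hF h2⟩,
          (hc b h1).1, (hc b h1).2.1⟩
      | zero => exact ⟨0, zero_mem _, zero_mem _, map_zero _⟩
      | add _ _ _ _ h₁ h₂ =>
        obtain ⟨z₁, h₁, h₁', rfl⟩ := h₁
        obtain ⟨z₂, h₂, h₂', rfl⟩ := h₂
        exact ⟨z₁ + z₂, add_mem h₁ h₂, add_mem h₁' h₂', map_add _ _ _⟩
      | smul a _ _ h =>
        obtain ⟨z, h, h', rfl⟩ := h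
        exact ⟨a • z, smul_mem _ _ h, smul_mem _ _ h', map_smul _ _ _⟩
    have hWF : W ⊓ F ∈ 𝓕 := by
      rcases h𝓕.total hW hF with h | h
      · rwa [inf_eq_left.2 h]
      · rwa [inf_eq_right.2 h]
    obtain ⟨z, hz, hzW, hpz⟩ := hlift (p w) (hAp _ hWF ⟨w, ⟨hwW, hwF⟩, rfl⟩)
    have hzF : z ∈ F := span_le.2 Set.inter_subset_right hz
    have hd := hCad F hF ⟨⟨sub_mem hwW hzW, by simp [hpz]⟩, sub_mem hwF hzF⟩
    have := add_mem
      (span_mono (Set.inter_subset_inter_left (F : Set V) Set.subset_union_left) hd)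
      (span_mono (Set.inter_subset_inter_left (F : Set V) (Set.subset_union_right (s := C))) hz)
    simpa using this
  refine ⟨C ∪ c '' A₂, hC.id_union (hpc.of_comp p).id_image ?_, le_antisymm ?_ ?_, hadD, ?_, ?_⟩
  · rw [hCspan]
    refine Disjoint.mono_left inf_le_right (Disjoint.symm ?_)
    simpa [Set.image_eq_range] using Submodule.range_ker_disjoint hpc
  · rw [span_le, Set.union_subset_iff]
    refine ⟨fun b hb => (hCspan ▸ subset_span hb : b ∈ W ⊓ LinearMap.ker p).1, ?_⟩
    rintro _ ⟨b, hb, rfl⟩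
    exact (hc b hb.2).1
  · exact fun w hw => span_mono Set.inter_subset_left (hadD W hW ⟨hw, hw⟩)
  · rintro d (hd | ⟨b, hb, rfl⟩)
    · exact Or.inl (hCspan ▸ subset_span hd : d ∈ W ⊓ LinearMap.ker p).2
    · exact Or.inr (by rw [(hc b hb.2).2.1]; exact hb.1)
  · intro b hb
    by_cases h : q b = 0
    · exact Or.inl h
    · exact Or.inr (Or.inl (hC₁C ⟨b, ⟨hb, h⟩, rfl⟩))

/-- `V = ⨁ G k` is graded, and the commuting endomorphisms `x`, `y` have degrees `1`, `-1`. -/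
structure WeightGrading {K V : Type*} [Field K] [AddCommGroup V] [Module K V]
    (x y : Module.End K V) (G : ℤ → Submodule K V) : Prop where
  comm : ∀ v, x (y v) = y (x v)
  map_x : ∀ k, ∀ v ∈ G k, x v ∈ G (k + 1)
  map_y : ∀ k, ∀ v ∈ G k, y v ∈ G (k - 1)
  internal : DirectSum.IsInternal G

/-- A basis of homogeneous vectors, each of which is sent by `x` (and by `y`) to zero or to
another basis vector. -/
def HasMonomialBasis {K V : Type*} [Field K] [AddCommGroup V] [Module K V]
    (x y : Module.End K V) (G : ℤ → Submodule K V) : Prop :=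
  ∃ b : Module.Basis (Fin (Module.finrank K V)) K V, (∀ i, ∃ k, b i ∈ G k) ∧
    (∀ i, x (b i) = 0 ∨ ∃ j, x (b i) = b j) ∧ ∀ i, y (b i) = 0 ∨ ∃ j, y (b i) = b j

theorem HasMonomialBasis.of_basis {K V ι : Type*} [Field K] [AddCommGroup V] [Module K V]
    [FiniteDimensional K V] {x y : Module.End K V} {G : ℤ → Submodule K V}
    (b : Module.Basis ι K V) (hb : ∀ i, ∃ k, b i ∈ G k)
    (hx : ∀ i, x (b i) = 0 ∨ ∃ j, x (b i) = b j)
    (hy : ∀ i, y (b i) = 0 ∨ ∃ j, y (b i) = b j) : HasMonomialBasis x y G := by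
  have : Fintype ι := FiniteDimensional.fintypeBasisIndex b
  let e : ι ≃ Fin (Module.finrank K V) :=
    Fintype.equivFinOfCardEq (Module.finrank_eq_card_basis b).symm
  refine ⟨b.reindex e, fun i => by simpa using hb _, fun i => ?_, fun i => ?_⟩
  · refine (hx (e.symm i)).imp (by simp) ?_
    rintro ⟨j, hj⟩
    exact ⟨e j, by simpa using hj⟩
  · refine (hy (e.symm i)).imp (by simp) ?_
    rintro ⟨j, hj⟩
    exact ⟨e j, by simpa using hj⟩

namespace WeightGrading

open Submodule

variable {K V : Type*} [Field K] [AddCommGroup V] [Module K V]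
  {x y : Module.End K V} {G : ℤ → Submodule K V}

theorem exists_bound [FiniteDimensional K V] (h : WeightGrading x y G) :
    ∃ m : ℕ, ∀ k : ℤ, (m : ℤ) < |k| → G k = ⊥ := by
  have hfin : {k | G k ≠ ⊥}.Finite :=
    WellFoundedGT.finite_ne_bot_of_iSupIndep h.internal.submodule_iSupIndep
  obtain ⟨m, hm⟩ := (hfin.image Int.natAbs).bddAbove
  refine ⟨m, fun k hk => ?_⟩
  by_contra hne
  have := hm ⟨k, hne, rfl⟩
  rw [lt_abs] at hk
  omega

theorem exists_adapted_bases [FiniteDimensional K V] (h : WeightGrading x y G)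
    (hxy : ∀ v, x (y v) = 0) {s : ℤ} (hs : ∀ k ≤ s, G k = ⊥) (n : ℕ)
    {𝓕 : Set (Submodule K V)} (h𝓕 : IsChain (· ≤ ·) 𝓕) (hbot : ⊥ ∈ 𝓕) (htop : G (s + n) ∈ 𝓕)
    (hle : ∀ F ∈ 𝓕, F ≤ G (s + n)) :
    ∃ B : ℤ → Set V, (∀ k ≤ s + n, LinearIndepOn K id (B k) ∧ span K (B k) = G k) ∧
      (∀ k < s + n, ∀ b ∈ B k, x b = 0 ∨ x b ∈ B (k + 1)) ∧
      (∀ k ≤ s + n, ∀ b ∈ B k, y b = 0 ∨ y b ∈ B (k - 1)) ∧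
      ∀ F ∈ 𝓕, F ≤ span K (B (s + n) ∩ F) := by
  induction n generalizing 𝓕 with
  | zero =>
    simp only [Nat.cast_zero, add_zero] at *
    refine ⟨fun _ => ∅, fun k hk => ⟨linearIndepOn_empty _ _, by simp [hs k hk]⟩, by simp,
      by simp, fun F hF => ?_⟩
    simpa [hs s le_rfl] using hle F hF
  | succ n ih =>
    have hn : s + ((n + 1 : ℕ) : ℤ) = s + n + 1 := by push_cast; ring
    rw [hn] at htop hle ⊢
    set U := G (s + n) with hU
    have hyU : ∀ F ∈ 𝓕, F.map y ≤ U := by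
      rintro F hF _ ⟨v, hv, rfl⟩
      simpa using h.map_y _ v (hle F hF hv)
    have hxU : U ≤ (G (s + n + 1)).comap x := fun v hv => h.map_x _ v hv
    have hmix : ∀ F ∈ 𝓕, ∀ F' ∈ 𝓕, F.map y ≤ U ⊓ F'.comap x := by
      intro F hF F' hF'
      refine le_inf (hyU F hF) ?_
      rintro _ ⟨v, hv, rfl⟩
      simp [hxy]
    obtain ⟨B, hB, hBx, hBy, hBad⟩ := ih
      (𝓕 := (fun F => F.map y) '' 𝓕 ∪ (fun F => U ⊓ F.comap x) '' 𝓕) (by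
        rintro _ (⟨F, hF, rfl⟩ | ⟨F, hF, rfl⟩) _ (⟨F', hF', rfl⟩ | ⟨F', hF', rfl⟩) -
        · exact (h𝓕.total hF hF').imp (fun h => map_mono h) fun h => map_mono h
        · exact Or.inl (hmix F hF F' hF')
        · exact Or.inr (hmix F' hF' F hF)
        · exact (h𝓕.total hF hF').imp (fun h => inf_le_inf_left _ (comap_mono h))
            fun h => inf_le_inf_left _ (comap_mono h))
      (Or.inl ⟨⊥, hbot, Submodule.map_bot _⟩) (Or.inr ⟨_, htop, inf_eq_left.2 hxU⟩) (by
        rintro _ (⟨F, hF, rfl⟩ | ⟨F, hF, rfl⟩)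
        · exact hyU F hF
        · exact inf_le_left)
    obtain ⟨D, hD, hDspan, hDad, hDy, hDx⟩ := exists_adapted_step (p := y) (q := x)
      (fun v => by rw [← h.comm, hxy]) hxU h𝓕 hbot htop (hB _ le_rfl).1 (hB _ le_rfl).2
      (fun F hF => hBad _ (Or.inl ⟨F, hF, rfl⟩)) (fun F hF => hBad _ (Or.inr ⟨F, hF, rfl⟩))
    have hlow : ∀ k ≤ s + n, Function.update B (s + n + 1) D k = B k := fun k hk =>
      Function.update_of_ne (by omega) _ _
    refine ⟨Function.update B (s + n + 1) D, fun k hk => ?_, fun k hk b hb => ?_,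
      fun k hk b hb => ?_, fun F hF => ?_⟩
    · rcases hk.lt_or_eq with hk | rfl
      · rw [hlow k (by omega)]
        exact hB k (by omega)
      · rw [Function.update_self]
        exact ⟨hD, hDspan⟩
    · rw [hlow k (by omega)] at hb
      rcases (show k ≤ s + n by omega).lt_or_eq with hk | rfl
      · rw [hlow _ (by omega)]
        exact hBx k hk b hb
      · rw [Function.update_self]
        exact hDx b hb
    · rcases hk.lt_or_eq with hk | rfl
      · rw [hlow k (by omega)] at hb
        rw [hlow _ (by omega)]
        exact hBy k (by omega) b hb
      · rw [Function.update_self] at hb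
        rw [hlow _ (by omega), add_sub_cancel_right]
        exact hDy b hb
    · rw [Function.update_self]
      exact (le_inf (hle F hF) le_rfl).trans (hDad F hF)

theorem hasMonomialBasis_of_comp_eq_zero [FiniteDimensional K V] (h : WeightGrading x y G)
    (hxy : ∀ v, x (y v) = 0) : HasMonomialBasis x y G := by
  obtain ⟨m, hm⟩ := h.exists_bound
  obtain ⟨B, hB, hBx, hBy, -⟩ := h.exists_adapted_bases hxy (s := -m - 1)
    (fun k hk => hm k (by rw [lt_abs]; omega)) (2 * m + 2) (𝓕 := {⊥, G (-m - 1 + (2 * m + 2 : ℕ))})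
    (IsChain.pair bot_le) (by simp) (by simp) (by simp)
  have htop : (-m - 1 + (2 * m + 2 : ℕ) : ℤ) = m + 1 := by push_cast; ring
  rw [htop] at hB hBx hBy
  have hBk : ∀ k, LinearIndepOn K id (B k ∩ {_v | k ≤ m}) ∧
      span K (B k ∩ {_v | k ≤ m}) = G k := by
    intro k
    by_cases hk : k ≤ m
    · simpa [hk] using hB k (by omega)
    · simp [hk, hm k (by rw [lt_abs]; omega)]
  let v : ∀ k, Module.Basis ↥(B k ∩ {_v | k ≤ m}) K (G k) := fun k =>
    (Module.Basis.span (hBk k).1.linearIndependent).map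
      (LinearEquiv.ofEq _ _ (by simp only [id, Subtype.range_coe, (hBk k).2]))
  have hv : ∀ k i, (v k i : V) = i := fun k i => by simp [v, Module.Basis.span_apply]
  refine .of_basis (h.internal.collectedBasis v)
    (fun i => ⟨i.1, h.internal.collectedBasis_mem v i⟩) ?_ ?_
  · rintro ⟨k, b, hb, hk⟩
    have hbG : b ∈ G k := by simpa only [hv] using (v k ⟨b, hb, hk⟩).2
    simp only [DirectSum.IsInternal.collectedBasis_coe, hv]
    refine or_iff_not_imp_left.2 fun hne => ?_
    have hxb : x b ∈ B (k + 1) := (hBx k (by simp at hk; omega) b hb).resolve_left hne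
    refine ⟨⟨k + 1, x b, hxb, ?_⟩, rfl⟩
    by_contra hk'
    have := h.map_x k b hbG
    rw [hm (k + 1) (by simp at hk'; rw [lt_abs]; omega)] at this
    exact hne this
  · rintro ⟨k, b, hb, hk⟩
    simp only [DirectSum.IsInternal.collectedBasis_coe, hv]
    have hk' : k ≤ m := hk
    refine (hBy k (by omega) b hb).imp_right fun hyb => ⟨⟨k - 1, y b, hyb, ?_⟩, rfl⟩
    change k - 1 ≤ m
    omega

theorem sum_filter_ne_eq_zero {ι : Type*} (hG : iSupIndep G) (s : Finset ι) (w : ι → ℤ)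
    (f : ι → V) (hf : ∀ i ∈ s, f i ∈ G (w i)) {d : ℤ} (hsum : ∑ i ∈ s, f i ∈ G d) :
    ∑ i ∈ s with w i ≠ d, f i = 0 := by
  refine Submodule.disjoint_def.1 (hG d) _ ?_ (sum_mem fun i hi => ?_)
  · rw [← Finset.sum_filter_add_sum_filter_not s (fun i => w i ≠ d)] at hsum
    refine (Submodule.add_mem_iff_left _ (sum_mem fun i hi => ?_)).1 hsum
    simp only [Finset.mem_filter, not_not] at hi
    exact hi.2 ▸ hf i hi.1
  · simp only [Finset.mem_filter] at hi
    exact (le_iSup₂_of_le (f := fun j (_ : j ≠ d) => G j) (w i) hi.2 le_rfl) (hf i hi.1)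

theorem repr_eq_zero {ι : Type*} [Fintype ι] (hG : iSupIndep G) (b : Module.Basis ι K V)
    {w : ι → ℤ} (hb : ∀ i, b i ∈ G (w i)) {d : ℤ} {u : V} (hu : u ∈ G d) {i : ι}
    (hi : w i ≠ d) : b.repr u i = 0 := by
  classical
  have := sum_filter_ne_eq_zero hG Finset.univ w (fun i => b.repr u i • b i)
    (fun i _ => smul_mem _ _ (hb i)) (d := d) (by rwa [b.sum_repr])
  exact linearIndependent_iff'.1 b.linearIndependent _ _ this i (by simp [hi])

theorem y_pow_mem (h : WeightGrading x y G) {k : ℤ} {v : V} (hv : v ∈ G k) (n : ℕ) :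
    (y ^ n) v ∈ G (k - n) := by
  induction n with
  | zero => simpa using hv
  | succ n ih =>
    rw [pow_succ', Module.End.mul_apply]
    convert h.map_y _ _ ih using 2
    push_cast; ring

theorem x_pow_mem (h : WeightGrading x y G) {k : ℤ} {v : V} (hv : v ∈ G k) (n : ℕ) :
    (x ^ n) v ∈ G (k + n) := by
  induction n with
  | zero => simpa using hv
  | succ n ih =>
    rw [pow_succ', Module.End.mul_apply]
    convert h.map_x _ _ ih using 2
    push_cast; ring

theorem commute (h : WeightGrading x y G) : Commute x y := LinearMap.ext h.comm

theorem isNilpotent_y [FiniteDimensional K V] (h : WeightGrading x y G) : IsNilpotent y := by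
  obtain ⟨m, hm⟩ := h.exists_bound
  refine ⟨2 * m + 1, ?_⟩
  rw [← LinearMap.ker_eq_top, eq_top_iff, ← h.internal.submodule_iSup_eq_top]
  refine iSup_le fun k v hv => ?_
  by_cases hk : (m : ℤ) < |k|
  · rw [hm k hk, mem_bot] at hv
    simp [hv]
  · have := h.y_pow_mem hv (2 * m + 1)
    rwa [hm, mem_bot] at this
    rw [lt_abs] at hk ⊢
    push_cast
    omega

theorem eq_zero_of_isNilpotent_of_apply_eq {f : Module.End K V} (hf : IsNilpotent f) {u : V}
    (hu : f u = u) : u = 0 := by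
  obtain ⟨n, hn⟩ := hf
  have : ∀ n, (f ^ n) u = u := fun n => by
    induction n with
    | zero => rfl
    | succ n ih => rw [pow_succ, Module.End.mul_apply, hu, ih]
  rw [← this n, hn, LinearMap.zero_apply]

theorem monomial_mem (h : WeightGrading x y G) {k : ℤ} {v : V} (hv : v ∈ G k) (t : ℕ × ℕ) :
    (x ^ t.1 * y ^ t.2) v ∈ G (k - t.2 + t.1) :=
  h.x_pow_mem (h.y_pow_mem hv _) _

theorem linearIndepOn_monomials [FiniteDimensional K V] (h : WeightGrading x y G) {k : ℤ} {v : V}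
    (hv : v ∈ G k) :
    LinearIndepOn K (fun t : ℕ × ℕ => (x ^ t.1 * y ^ t.2) v) {t | (x ^ t.1 * y ^ t.2) v ≠ 0} := by
  classical
  rw [linearIndepOn_iff]
  intro l hl hsum
  by_contra hne
  obtain ⟨t, ht, hmin⟩ := Finset.exists_min_image l.support Prod.snd
    (Finsupp.support_nonempty_iff.2 hne)
  rw [Finsupp.linearCombination_apply, Finsupp.sum] at hsum
  have hsum' := sum_filter_ne_eq_zero h.internal.submodule_iSupIndep l.support
    (fun t => k - t.2 + t.1) _ (fun t _ => smul_mem _ (l t) (h.monomial_mem hv t))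
    (d := k - t.2 + t.1) (by rw [hsum]; exact zero_mem _)
  rw [← Finset.sum_filter_add_sum_filter_not l.support
    (fun i => k - i.2 + i.1 ≠ k - t.2 + t.1), hsum', zero_add,
    ← Finset.add_sum_erase _ _ (a := t) (by simpa using ht)] at hsum
  set u := (x ^ t.1 * y ^ t.2) v with hu
  set s := (l.support.filter fun i => ¬ k - i.2 + i.1 ≠ k - t.2 + t.1).erase t
  let g : Module.End K V := ∑ i ∈ s, l i • (x ^ (i.1 - t.1) * y ^ (i.2 - t.2 - 1))
  have hyg : (y * g) u = ∑ i ∈ s, l i • (x ^ i.1 * y ^ i.2) v := by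
    simp only [g, Finset.mul_sum, LinearMap.sum_apply]
    refine Finset.sum_congr rfl fun i hi => ?_
    simp only [s, Finset.mem_erase, Finset.mem_filter, not_not] at hi
    obtain ⟨hit, his, hw⟩ := hi
    have h2 := hmin i his
    have h3 : t.2 ≠ i.2 := fun h' => hit (Prod.ext (by omega) h'.symm)
    rw [mul_smul_comm, LinearMap.smul_apply, hu, ← Module.End.mul_apply]
    congr 2
    obtain ⟨a, ha⟩ : ∃ a, i.1 = a + t.1 := ⟨i.1 - t.1, by omega⟩
    obtain ⟨c, hc⟩ : ∃ c, i.2 = c + 1 + t.2 := ⟨i.2 - t.2 - 1, by omega⟩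
    have e1 : i.1 - t.1 = a := by omega
    have e2 : i.2 - t.2 - 1 = c := by omega
    rw [e1, e2, ha, hc, pow_add x, pow_add y, pow_succ' y]
    have c1 := (h.commute.pow_right c).pow_left t.1
    have c2 := h.commute.pow_left a
    have c3 := h.commute.pow_left t.1
    calc y * (x ^ a * y ^ c) * (x ^ t.1 * y ^ t.2)
        = (y * x ^ a) * (y ^ c * x ^ t.1) * y ^ t.2 := by noncomm_ring
      _ = x ^ a * (y * x ^ t.1) * y ^ c * y ^ t.2 := by
          rw [← c2.eq, ← c1.eq]; noncomm_ring
      _ = x ^ a * x ^ t.1 * (y * y ^ c * y ^ t.2) := by rw [← c3.eq]; noncomm_ring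
  have hcomm : Commute y g := by
    refine Commute.sum_right _ _ _ fun i _ => Commute.smul_right ?_ _
    exact (h.commute.symm.pow_right _).mul_right ((Commute.refl y).pow_right _)
  have hlt : l t ≠ 0 := Finsupp.mem_support_iff.1 ht
  have hnil : IsNilpotent (y * (-(l t)⁻¹ • g)) :=
    Commute.isNilpotent_mul_right (hcomm.smul_right _) h.isNilpotent_y
  refine (hl ht : u ≠ 0) (eq_zero_of_isNilpotent_of_apply_eq hnil ?_)
  rw [mul_smul_comm, LinearMap.smul_apply, hyg, eq_neg_of_add_eq_zero_right hsum]
  simp [hlt, hu]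

theorem exists_homogeneous_notMem (h : WeightGrading x y G) {S : Submodule K V} (hS : S ≠ ⊤) :
    ∃ k, ∃ v ∈ G k, v ∉ S := by
  by_contra! hne
  refine hS (top_le_iff.1 ?_)
  rw [← h.internal.submodule_iSup_eq_top]
  exact iSup_le hne

theorem hasMonomialBasis_of_cyclic [FiniteDimensional K V] (h : WeightGrading x y G) {k : ℤ}
    {v : V} (hv : v ∈ G k) (hspan : span K ((fun t : ℕ × ℕ => (x ^ t.1 * y ^ t.2) v) ''
      {t | (x ^ t.1 * y ^ t.2) v ≠ 0}) = ⊤) : HasMonomialBasis x y G := by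
  let b := Module.Basis.mk (h.linearIndepOn_monomials hv).linearIndependent
    (by rw [← hspan, Set.image_eq_range])
  have hb : ∀ t, b t = (x ^ t.1.1 * y ^ t.1.2) v := fun t => by simp [b]
  refine .of_basis b (fun t => ⟨_, (hb t).symm ▸ h.monomial_mem hv t⟩) (fun t => ?_) fun t => ?_
  · have hx : x (b t) = (x ^ (t.1.1 + 1) * y ^ t.1.2) v := by
      rw [hb, pow_succ', mul_assoc]; rfl
    by_cases h0 : x (b t) = 0
    · exact Or.inl h0
    · exact Or.inr ⟨_, hx.trans (hb ⟨(t.1.1 + 1, t.1.2), fun hz => h0 (hx.trans hz)⟩).symm⟩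
  · have hy : y (b t) = (x ^ t.1.1 * y ^ (t.1.2 + 1)) v := by
      rw [hb, pow_succ', ← mul_assoc, (h.commute.pow_left _).eq, mul_assoc]; rfl
    by_cases h0 : y (b t) = 0
    · exact Or.inl h0
    · exact Or.inr ⟨_, hy.trans (hb ⟨(t.1.1, t.1.2 + 1), fun hz => h0 (hy.trans hz)⟩).symm⟩

/-- The complement `w` of the submodule spanned by `v, x v, y v, x (y v)` can be corrected so that
it becomes part of a monomial basis. -/
theorem hasMonomialBasis_of_codim_one [FiniteDimensional K V] (h : WeightGrading x y G) {k j : ℤ}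
    {v w : V} (hv : v ∈ G k) (hw : w ∈ G j) (hxx : x (x v) = 0) (hyy : y (y v) = 0)
    (b : Module.Basis (Fin 5) K V) (hb : ⇑b = ![v, x v, y v, x (y v), w]) :
    HasMonomialBasis x y G := by
  have hG := h.internal.submodule_iSupIndep
  have hli := Fintype.linearIndependent_iff.1 b.linearIndependent
  let ω : Fin 5 → ℤ := ![k, k + 1, k - 1, k, j]
  have hxv := h.map_x _ _ hv
  have hyv := h.map_y _ _ hv
  have hbω : ∀ i, b i ∈ G (ω i) := by
    intro i
    rw [hb]
    fin_cases i
    · exact hv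
    · exact hxv
    · exact hyv
    · simpa [ω] using h.map_x _ _ hyv
    · exact hw
  have key : ∀ u d, u ∈ G d → d ≠ j → ∃ c₁ c₂ c₃ c₄ : K,
      u = c₁ • v + c₂ • x v + c₃ • y v + c₄ • x (y v) ∧ (c₁ ≠ 0 → d = k) ∧ (c₂ ≠ 0 → d = k + 1) ∧
      (c₃ ≠ 0 → d = k - 1) ∧ (c₄ ≠ 0 → d = k) := by
    intro u d hu hd
    have hz : ∀ i, b.repr u i ≠ 0 → d = ω i := fun i hi => by
      by_contra hne
      exact hi (repr_eq_zero hG b hbω hu (Ne.symm hne))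
    refine ⟨b.repr u 0, b.repr u 1, b.repr u 2, b.repr u 3, ?_, hz 0, hz 1, hz 2, hz 3⟩
    have h4 : b.repr u 4 = 0 := by
      by_contra hne
      exact hd (hz 4 hne)
    conv_lhs => rw [← b.sum_repr u]
    simp [Fin.sum_univ_five, h4, hb]
  obtain ⟨c₁, c₂, c₃, c₄, hxw, -, hc₂, hc₃, hc₄⟩ := key _ _ (h.map_x _ _ hw) (by omega)
  obtain ⟨d₁, d₂, d₃, d₄, hyw, -, hd₂, hd₃, hd₄⟩ := key _ _ (h.map_y _ _ hw) (by omega)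
  have hxxy : x (x (y v)) = 0 := by rw [h.comm, h.comm, hxx, map_zero]
  have hyxy : y (x (y v)) = 0 := by rw [← h.comm, hyy, map_zero]
  have hcomm := h.comm w
  simp only [hxw, hyw, map_add, map_smul, ← h.comm, hxx, hyy, hxxy, smul_zero, add_zero,
    map_zero] at hcomm
  have hrel := hli ![0, d₁, -c₁, d₃ - c₂, 0] (by
    simp only [Fin.sum_univ_five, hb]
    simp only [Matrix.cons_val]
    rw [← sub_eq_zero] at hcomm
    rw [← hcomm]
    module)
  have hd₁ : d₁ = 0 := hrel 1
  have hc₁ : c₁ = 0 := by simpa using hrel 2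
  have hcd : d₃ = c₂ := by simpa [sub_eq_zero] using hrel 3
  subst hd₁ hc₁ hcd
  set w' := w - (d₃ • v + c₄ • y v + d₄ • x v) with hw'
  have hsm : ∀ (c : K) (u : V) (d : ℤ), u ∈ G d → (c ≠ 0 → d = j) → c • u ∈ G j := by
    intro c u d hu hcj
    by_cases hc : c = 0
    · simp [hc]
    · exact smul_mem _ _ (hcj hc ▸ hu)
  have hw'G : w' ∈ G j := by
    refine sub_mem hw (add_mem (add_mem (hsm _ _ _ hv ?_) (hsm _ _ _ hyv ?_)) (hsm _ _ _ hxv ?_))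
    · intro hne; have := hc₂ hne; omega
    · intro hne; have := hc₄ hne; omega
    · intro hne; have := hd₄ hne; omega
  have hxw' : x w' = c₃ • y v := by
    simp only [hw', map_sub, map_add, map_smul, hxw, hxx]
    module
  have hyw' : y w' = d₂ • x v := by
    simp only [hw', map_sub, map_add, map_smul, hyw, hyy, ← h.comm]
    module
  have hcd : c₃ = 0 ∨ d₂ = 0 := by
    by_contra! hne
    have := hc₃ hne.1
    have := hd₂ hne.2
    omega
  have main : ∀ a : K, a ≠ 0 → (a * c₃ = 0 ∨ a * c₃ = 1) → (a * d₂ = 0 ∨ a * d₂ = 1) →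
      HasMonomialBasis x y G := by
    intro a ha hac had
    have hli' : LinearIndependent K ![v, x v, y v, x (y v), a • w'] := by
      rw [Fintype.linearIndependent_iff]
      intro g hg
      have hrel := hli ![g 0 - g 4 * a * d₃, g 1 - g 4 * a * d₄, g 2 - g 4 * a * c₄, g 3,
        g 4 * a] (by
          simp only [Fin.sum_univ_five, hb, hw'] at hg ⊢
          simp only [Matrix.cons_val] at hg ⊢
          rw [← hg]
          module)
      have h4 : g 4 = 0 := by simpa [ha] using hrel 4
      have h0 := hrel 0
      have h1 := hrel 1
      have h2 := hrel 2
      have h3 : g 3 = 0 := hrel 3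
      simp [h4] at h0 h1 h2
      intro i
      fin_cases i <;> assumption
    let b' := basisOfLinearIndependentOfCardEqFinrank hli'
      (by rw [Module.finrank_eq_card_basis b])
    have hb' : ⇑b' = ![v, x v, y v, x (y v), a • w'] := by simp [b']
    refine .of_basis b' (fun i => ⟨ω i, ?_⟩) (fun i => ?_) fun i => ?_
    · rw [hb']
      fin_cases i
      · exact hv
      · exact hxv
      · exact hyv
      · simpa [ω] using h.map_x _ _ hyv
      · exact smul_mem _ _ hw'G
    · rw [hb']
      fin_cases i
      · exact Or.inr ⟨1, rfl⟩
      · exact Or.inl hxx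
      · exact Or.inr ⟨3, rfl⟩
      · exact Or.inl hxxy
      · change x (a • w') = 0 ∨ _
        rw [map_smul, hxw', smul_smul]
        rcases hac with hac | hac
        · exact Or.inl (by simp [hac])
        · exact Or.inr ⟨2, by change x (a • w') = y v; rw [map_smul, hxw', smul_smul, hac, one_smul]⟩
    · rw [hb']
      fin_cases i
      · exact Or.inr ⟨2, rfl⟩
      · exact Or.inr ⟨3, (h.comm v).symm⟩
      · exact Or.inl hyy
      · exact Or.inl hyxy
      · change y (a • w') = 0 ∨ _
        rw [map_smul, hyw', smul_smul]
        rcases had with had | had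
        · exact Or.inl (by simp [had])
        · exact Or.inr ⟨1, by change y (a • w') = x v; rw [map_smul, hyw', smul_smul, had, one_smul]⟩
  by_cases hc : c₃ = 0
  · by_cases hd : d₂ = 0
    · exact main 1 one_ne_zero (by simp [hc]) (by simp [hd])
    · exact main d₂⁻¹ (inv_ne_zero hd) (by simp [hc]) (by simp [hd])
  · exact main c₃⁻¹ (inv_ne_zero hc) (by simp [hc]) (by simp [hcd.resolve_left hc])

theorem hasMonomialBasis_of_finrank_le_five [FiniteDimensional K V] (h : WeightGrading x y G)
    (hdim : Module.finrank K V ≤ 5) : HasMonomialBasis x y G := by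
  by_cases hxy : LinearMap.ker (x * y) = ⊤
  · exact h.hasMonomialBasis_of_comp_eq_zero fun v => LinearMap.congr_fun
      (LinearMap.ker_eq_top.1 hxy) v
  obtain ⟨k, v, hv, hvxy⟩ := h.exists_homogeneous_notMem hxy
  have hvxy : x (y v) ≠ 0 := hvxy
  by_cases hspan : span K ((fun t : ℕ × ℕ => (x ^ t.1 * y ^ t.2) v) ''
      {t | (x ^ t.1 * y ^ t.2) v ≠ 0}) = ⊤
  · exact h.hasMonomialBasis_of_cyclic hv hspan
  have hmon := h.linearIndepOn_monomials hv
  obtain ⟨j, w, hw, hwS⟩ := h.exists_homogeneous_notMem hspan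
  obtain ⟨T, hT⟩ : ∃ T, T = {t : ℕ × ℕ | (x ^ t.1 * y ^ t.2) v ≠ 0} := ⟨_, rfl⟩
  rw [← hT] at hmon hwS
  replace hT : ∀ t, t ∈ T ↔ (x ^ t.1 * y ^ t.2) v ≠ 0 := fun t => by rw [hT]; rfl
  have hT0 : (0, 0) ∈ T := (hT _).2 <| by rintro (h0 : v = 0); simp [h0] at hvxy
  have hT1 : (1, 0) ∈ T := (hT _).2 <| by
    intro h0
    have h0 : x v = 0 := by simpa using h0
    rw [h.comm, h0, map_zero] at hvxy
    exact hvxy rfl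
  have hT2 : (0, 1) ∈ T := (hT _).2 <| by
    intro h0
    have h0 : y v = 0 := by simpa using h0
    rw [h0, map_zero] at hvxy
    exact hvxy rfl
  have hT3 : (1, 1) ∈ T := (hT _).2 <| by simpa using hvxy
  have hcons : ∀ {n : ℕ} (f : Fin n → ℕ × ℕ), Function.Injective f → (∀ i, f i ∈ T) →
      LinearIndependent K (Fin.snoc (fun i => (x ^ (f i).1 * y ^ (f i).2) v) w : Fin (n + 1) → V) := by
    intro n f hf hfT
    refine LinearIndependent.finSnoc (hmon.linearIndependent.comp
      (fun i => (⟨f i, hfT i⟩ : T)) fun i i' hi => hf (by simpa using hi)) fun hmem => hwS ?_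
    refine span_mono ?_ hmem
    rintro _ ⟨i, rfl⟩
    exact ⟨f i, hfT i, rfl⟩
  have hnot : ∀ t, Function.Injective ![(0, 0), (1, 0), (0, 1), (1, 1), t] → t ∉ T := by
    intro t hinj ht
    have := (hcons _ hinj (by
      simp [Fin.forall_fin_succ, hT0, hT1, hT2, hT3, ht])).fintype_card_le_finrank
    rw [Fintype.card_fin] at this
    omega
  have hxx : x (x v) = 0 := by
    by_contra hne
    exact hnot (2, 0) (by decide) ((hT _).2 <| by simpa [pow_two] using hne)
  have hyy : y (y v) = 0 := by
    by_contra hne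
    exact hnot (0, 2) (by decide) ((hT _).2 <| by simpa [pow_two] using hne)
  have hfam := hcons ![(0, 0), (1, 0), (0, 1), (1, 1)] (by decide)
    (by simp [Fin.forall_fin_succ, hT0, hT1, hT2, hT3])
  have hfam_eq : (Fin.snoc (fun i => (x ^ (![((0 : ℕ), (0 : ℕ)), (1, 0), (0, 1), (1, 1)] i).1 *
      y ^ (![((0 : ℕ), (0 : ℕ)), (1, 0), (0, 1), (1, 1)] i).2) v) w : Fin 5 → V) =
      ![v, x v, y v, x (y v), w] := by
    funext i
    fin_cases i
    · simp [Fin.snoc]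
    · simp [Fin.snoc]
    · change (x ^ 0 * y ^ 1) v = y v
      simp
    · change (x ^ 1 * y ^ 1) v = x (y v)
      simp
    · simp [Fin.snoc]
  rw [hfam_eq] at hfam
  have hcard : Fintype.card (Fin 5) = Module.finrank K V :=
    le_antisymm hfam.fintype_card_le_finrank (by simpa using hdim)
  exact h.hasMonomialBasis_of_codim_one hv hw hxx hyy
    (basisOfLinearIndependentOfCardEqFinrank hfam hcard) (by simp)

end WeightGrading

namespace E2Mod

open Submodule

variable {M N : E2Mod}

theorem mem_wt {k : ℤ} {v : M.V} : v ∈ M.wt k ↔ M.L v = (k : ℂ) • v := by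
  simp [wt, sub_eq_zero]

theorem weightGrading (M : E2Mod) : WeightGrading M.Pp M.Pm M.wt where
  comm := LinearMap.congr_fun M.comm
  map_x k v hv := by
    have := LinearMap.congr_fun M.relp v
    simp only [LinearMap.sub_apply, LinearMap.comp_apply, mem_wt.1 hv, map_smul] at this
    rw [mem_wt, sub_eq_iff_eq_add.1 this]
    push_cast
    module
  map_y k v hv := by
    have := LinearMap.congr_fun M.relm v
    simp only [LinearMap.sub_apply, LinearMap.comp_apply, mem_wt.1 hv, map_smul,
      LinearMap.neg_apply] at this
    rw [mem_wt, sub_eq_iff_eq_add.1 this]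
    push_cast
    module
  internal := M.internal

theorem isSubmod_biSup_wt {s : Set ℤ} (hs : ∀ k ∈ s, M.wt (k + 1) ≠ ⊥ → k + 1 ∈ s)
    (hs' : ∀ k ∈ s, M.wt (k - 1) ≠ ⊥ → k - 1 ∈ s) : M.IsSubmod (⨆ k ∈ s, M.wt k) := by
  have aux : ∀ k ∈ s, ∀ j, (M.wt j ≠ ⊥ → j ∈ s) → M.wt j ≤ ⨆ k ∈ s, M.wt k := by
    intro k hk j hj
    by_cases h0 : M.wt j = ⊥
    · simp [h0]
    · exact le_biSup M.wt (hj h0)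
  refine ⟨?_, ?_, ?_⟩
  · suffices (⨆ k ∈ s, M.wt k) ≤ comap M.Pp (⨆ k ∈ s, M.wt k) from this
    exact iSup₂_le fun k hk v hv => aux k hk _ (hs k hk) (M.weightGrading.map_x k v hv)
  · suffices (⨆ k ∈ s, M.wt k) ≤ comap M.Pm (⨆ k ∈ s, M.wt k) from this
    exact iSup₂_le fun k hk v hv => aux k hk _ (hs' k hk) (M.weightGrading.map_y k v hv)
  · suffices (⨆ k ∈ s, M.wt k) ≤ comap M.L (⨆ k ∈ s, M.wt k) from this
    refine iSup₂_le fun k hk v hv => le_biSup M.wt hk ?_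
    rw [mem_wt.1 hv]
    exact smul_mem _ _ hv

theorem Indecomposable.wt_eq_bot_of_lt (hM : M.Indecomposable) {a k : ℤ} (ha : M.wt a ≠ ⊥)
    (hak : a < k) (hk : M.wt k = ⊥) {j : ℤ} (hj : k < j) : M.wt j = ⊥ := by
  have h1 : M.IsSubmod (⨆ i ∈ Set.Iio k, M.wt i) := by
    refine isSubmod_biSup_wt (fun i hi hne => ?_) fun i hi _ => ?_ <;>
      simp only [Set.mem_Iio] at hi ⊢
    · have : i + 1 ≠ k := by rintro rfl; exact hne hk
      omega
    · omega
  have h2 : M.IsSubmod (⨆ i ∈ Set.Ioi k, M.wt i) := by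
    refine isSubmod_biSup_wt (fun i hi _ => ?_) fun i hi hne => ?_ <;>
      simp only [Set.mem_Ioi] at hi ⊢
    · omega
    · have : i - 1 ≠ k := by rintro rfl; exact hne hk
      omega
  have hdisj : Disjoint (⨆ i ∈ Set.Iio k, M.wt i) (⨆ i ∈ Set.Ioi k, M.wt i) :=
    M.internal.submodule_iSupIndep.disjoint_biSup_biSup (by
      rw [Set.disjoint_left]
      intro i hi hi'
      exact lt_asymm (Set.mem_Iio.1 hi) (Set.mem_Ioi.1 hi'))
  have hsup : (⨆ i ∈ Set.Iio k, M.wt i) ⊔ (⨆ i ∈ Set.Ioi k, M.wt i) = ⊤ := by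
    rw [eq_top_iff, ← M.weightGrading.internal.submodule_iSup_eq_top]
    refine iSup_le fun i => ?_
    rcases lt_trichotomy i k with hi | rfl | hi
    · exact le_sup_of_le_left (le_biSup M.wt hi)
    · simp [hk]
    · exact le_sup_of_le_right (le_biSup M.wt hi)
  rcases hM.2 _ _ h1 h2 hdisj.eq_bot hsup with h | h
  · exact absurd (eq_bot_mono (le_biSup M.wt (Set.mem_Iio.2 hak)) h) ha
  · exact eq_bot_mono (le_biSup M.wt (Set.mem_Ioi.2 hj)) h

theorem Indecomposable.wt_eq_bot_of_finrank_le (hM : M.Indecomposable) {a : ℤ}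
    (ha : M.wt a ≠ ⊥) {n : ℕ} (hn : Module.finrank ℂ M.V ≤ n) {j : ℤ} (hj : a + n ≤ j) :
    M.wt j = ⊥ := by
  classical
  obtain ⟨i, hi⟩ : ∃ i : Fin (n + 1), M.wt (a + i) = ⊥ := by
    by_contra! hne
    have hind : iSupIndep fun i : Fin (n + 1) => M.wt (a + i) :=
      M.weightGrading.internal.submodule_iSupIndep.comp (f := fun i : Fin (n + 1) => a + (i : ℤ))
        fun i i' h => by simpa [Fin.ext_iff] using h
    have := hind.subtype_ne_bot_le_finrank
    rw [Fintype.card_subtype, Finset.filter_true_of_mem fun i _ => hne i, Finset.card_univ,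
      Fintype.card_fin] at this
    omega
  have hi0 : (i : ℕ) ≠ 0 := by
    intro h0
    exact ha (by simpa [h0] using hi)
  rcases eq_or_ne j (a + i) with rfl | hne
  · exact hi
  · exact hM.wt_eq_bot_of_lt ha (by omega) hi (by omega)

/-- The shape of a monomial basis with `n` elements: the weights of the basis vectors relative to
the lowest weight, and for each basis vector its image under `P₊` and `P₋` (`none` means zero). -/
abbrev Shape (n : ℕ) : Type := (Fin n → Fin 5) × (Fin n → Option (Fin n)) × (Fin n → Option (Fin n))

/-- `M` has a monomial basis of the given shape. -/
def Realizes (a : ℤ) (d : Σ n : Fin 6, Shape n) (M : E2Mod) : Prop :=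
  ∃ b : Module.Basis (Fin d.1) ℂ M.V, ∀ i,
    M.L (b i) = ((a + (d.2.1 i : ℕ) : ℤ) : ℂ) • b i ∧
    M.Pp (b i) = (d.2.2.1 i).elim 0 b ∧ M.Pm (b i) = (d.2.2.2 i).elim 0 b

theorem Realizes.iso {a : ℤ} {d : Σ n : Fin 6, Shape n} (hM : Realizes a d M)
    (hN : Realizes a d N) : M.Iso N := by
  obtain ⟨b, hb⟩ := hM
  obtain ⟨c, hc⟩ := hN
  have he : ∀ i, b.equiv c (Equiv.refl _) (b i) = c i := fun i => by simp
  have helim : ∀ o : Option (Fin d.1), b.equiv c (Equiv.refl _) (o.elim 0 b) = o.elim 0 c := by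
    rintro (_ | i) <;> simp
  refine ⟨b.equiv c (Equiv.refl _), fun v => ?_, fun v => ?_, fun v => ?_⟩
  · refine LinearMap.congr_fun (f := (b.equiv c (Equiv.refl _)).toLinearMap ∘ₗ M.Pp)
      (g := N.Pp ∘ₗ (b.equiv c (Equiv.refl _)).toLinearMap) (b.ext fun i => ?_) v
    change b.equiv c _ (M.Pp (b i)) = N.Pp (b.equiv c _ (b i))
    rw [he, (hb i).2.1, (hc i).2.1, helim]
  · refine LinearMap.congr_fun (f := (b.equiv c (Equiv.refl _)).toLinearMap ∘ₗ M.Pm)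
      (g := N.Pm ∘ₗ (b.equiv c (Equiv.refl _)).toLinearMap) (b.ext fun i => ?_) v
    change b.equiv c _ (M.Pm (b i)) = N.Pm (b.equiv c _ (b i))
    rw [he, (hb i).2.2, (hc i).2.2, helim]
  · refine LinearMap.congr_fun (f := (b.equiv c (Equiv.refl _)).toLinearMap ∘ₗ M.L)
      (g := N.L ∘ₗ (b.equiv c (Equiv.refl _)).toLinearMap) (b.ext fun i => ?_) v
    change b.equiv c _ (M.L (b i)) = N.L (b.equiv c _ (b i))
    rw [he, (hb i).1, (hc i).1, map_smul, he]

theorem Indecomposable.exists_realizes (hM : M.Indecomposable)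
    (hdim : Module.finrank ℂ M.V ≤ 5) {a : ℤ} (ha : M.wt a ≠ ⊥)
    (hlow : ∀ k < a, M.wt k = ⊥) : ∃ d, Realizes a d M := by
  obtain ⟨b, hw, hx, hy⟩ := M.weightGrading.hasMonomialBasis_of_finrank_le_five hdim
  have hw' : ∀ i, ∃ r : Fin 5, M.L (b i) = ((a + (r : ℕ) : ℤ) : ℂ) • b i := by
    intro i
    obtain ⟨k, hk⟩ := hw i
    have hne : M.wt k ≠ ⊥ := fun h0 => b.ne_zero i (by simpa [h0] using hk)
    have h1 : a ≤ k := not_lt.1 fun h => hne (hlow k h)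
    have h2 : k < a + 5 := not_le.1 fun h => hne (hM.wt_eq_bot_of_finrank_le ha hdim h)
    refine ⟨⟨(k - a).toNat, by omega⟩, ?_⟩
    rw [mem_wt.1 hk]
    congr 2
    simp only
    omega
  have key : ∀ f : M.V →ₗ[ℂ] M.V, (∀ i, f (b i) = 0 ∨ ∃ j, f (b i) = b j) →
      ∀ i, ∃ o : Option (Fin (Module.finrank ℂ M.V)), f (b i) = o.elim 0 b := by
    intro f hf i
    rcases hf i with h | ⟨j, h⟩
    · exact ⟨none, h⟩
    · exact ⟨some j, h⟩
  choose r hr using hw'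
  choose px hpx using key _ hx
  choose py hpy using key _ hy
  exact ⟨⟨⟨Module.finrank ℂ M.V, by omega⟩, r, px, py⟩, b, fun i => ⟨hr i, hpx i, hpy i⟩⟩

end E2Mod

/-- For every `a ∈ ℤ`, there are finitely many isomorphism classes of indecomposable
`e(2)`-modules with lowest weight `a` and complex dimension at most five. -/
theorem stmt_2 (a : ℤ) :
    ∃ (n : ℕ) (Vs : Fin n → E2Mod),
      ∀ M : E2Mod, M.Indecomposable → Module.finrank ℂ M.V ≤ 5 →
        M.wt a ≠ ⊥ → (∀ k : ℤ, k < a → M.wt k = ⊥) →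
        ∃ j : Fin n, M.Iso (Vs j) := by
  classical
  let D := {d : Σ n : Fin 6, E2Mod.Shape n // ∃ M, E2Mod.Realizes a d M}
  obtain ⟨n, ⟨e⟩⟩ := Finite.exists_equiv_fin D
  refine ⟨n, fun j => (e.symm j).2.choose, fun M hM hdim ha hlow => ?_⟩
  obtain ⟨d, hd⟩ := hM.exists_realizes hdim ha hlow
  refine ⟨e ⟨d, M, hd⟩, hd.iso ?_⟩
  simpa using (e.symm (e ⟨d, M, hd⟩)).2.choose_spec
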